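/- arXiv:2205.13431 — 2 statements merged into one kernel-verified Lean document; each statement's English description precedes it below -/
import Mathlib

section
/- Let B₁ and B₂ be two 3×2 full column rank matrices over a field F. Then there exist an invertible 3×3 matrix P, invertible 2×2 matrices D₁, D₂, and 3×2 matrices R₁, R₂ each consisting of two distinct columns of I₃, such that P·Bᵢ·Dᵢ = Rᵢ for i = 1, 2. -/
open Matrix

theorem fin_aux {F : Type*} [Field F] (B₁ B₂ : Matrix (Fin 3) (Fin 2) F)
    (Q : Matrix (Fin 3) (Fin 3) F) (hQ : IsUnit Q) (D₁ D₂ : Matrix (Fin 2) (Fin 2) F)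
    (h₁ : IsUnit D₁) (h₂ : IsUnit D₂) (f g : Fin 2 → Fin 3)
    (hf : Function.Injective f) (hg : Function.Injective g)
    (e₁ : B₁ * D₁ = Q.submatrix id f) (e₂ : B₂ * D₂ = Q.submatrix id g) :
    ∃ (P : Matrix (Fin 3) (Fin 3) F) (D₁ D₂ : Matrix (Fin 2) (Fin 2) F)
      (R₁ R₂ : Matrix (Fin 3) (Fin 2) F),
      IsUnit P ∧ IsUnit D₁ ∧ IsUnit D₂ ∧
      (∃ f : Fin 2 → Fin 3, Function.Injective f ∧
        ∀ i k, R₁ i k = if i = f k then 1 else 0) ∧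
      (∃ g : Fin 2 → Fin 3, Function.Injective g ∧
        ∀ i k, R₂ i k = if i = g k then 1 else 0) ∧
      P * B₁ * D₁ = R₁ ∧ P * B₂ * D₂ = R₂ := by
  have key : ∀ f : Fin 2 → Fin 3, Q⁻¹ * Q.submatrix id f =
      (1 : Matrix (Fin 3) (Fin 3) F).submatrix id f := by
    intro f
    have h : Q⁻¹ * Q = 1 := Matrix.nonsing_inv_mul _ ((Matrix.isUnit_iff_isUnit_det _).1 hQ)
    rw [← h]
    ext i j
    simp [Matrix.mul_apply]
  refine ⟨Q⁻¹, D₁, D₂, (1 : Matrix (Fin 3) (Fin 3) F).submatrix id f,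
    (1 : Matrix (Fin 3) (Fin 3) F).submatrix id g, ?_, h₁, h₂, ⟨f, hf, ?_⟩, ⟨g, hg, ?_⟩, ?_, ?_⟩
  · exact (Matrix.isUnit_nonsing_inv_iff).2 hQ
  · intro i k; simp [Matrix.one_apply]
  · intro i k; simp [Matrix.one_apply]
  · rw [Matrix.mul_assoc, e₁, key]
  · rw [Matrix.mul_assoc, e₂, key]

theorem basis_aux {F : Type*} [Field F] (B : Matrix (Fin 3) (Fin 2) F)
    (hB : LinearIndependent F Bᵀ) (c : Fin 3 → F)
    (hc : c ∉ Submodule.span F (Set.range Bᵀ)) :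
    IsUnit (Matrix.of fun i (j : Fin 3) => (![B i 0, B i 1, c i] : Fin 3 → F) j) := by
  rw [← Matrix.linearIndependent_cols_iff_isUnit]
  have h := (linearIndependent_finSnoc (K := F) (v := Bᵀ) (x := c)).2 ⟨hB, hc⟩
  have he : (Matrix.of fun i (j : Fin 3) => (![B i 0, B i 1, c i] : Fin 3 → F) j).col =
      Fin.snoc (α := fun _ => Fin 3 → F) Bᵀ c := by
    funext j i
    fin_cases j <;> rfl
  rw [he]
  exact h

theorem case_aux {F : Type*} [Field F] (B₁ B₂ : Matrix (Fin 3) (Fin 2) F)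
    (hB₁ : LinearIndependent F B₁ᵀ) (hB₂ : LinearIndependent F B₂ᵀ)
    (hc : B₂ᵀ 1 ∉ Submodule.span F (Set.range B₁ᵀ)) :
    ∃ (Q : Matrix (Fin 3) (Fin 3) F) (D₁ D₂ : Matrix (Fin 2) (Fin 2) F),
      IsUnit Q ∧ IsUnit D₁ ∧ IsUnit D₂ ∧ B₁ * D₁ = Q.submatrix id ![0, 1] ∧
      B₂ * D₂ = Q.submatrix id ![0, 2] := by
  have hA := basis_aux B₁ hB₁ _ hc
  set A := (Matrix.of fun i (j : Fin 3) => (![B₁ i 0, B₁ i 1, B₂ᵀ 1 i] : Fin 3 → F) j) with hAdef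
  obtain ⟨x, y, z, h⟩ : ∃ x y z : F, ∀ i, B₂ i 0 = x * B₁ i 0 + y * B₁ i 1 + z * B₂ i 1 := by
    have h : A *ᵥ (A⁻¹ *ᵥ (B₂ᵀ 0)) = B₂ᵀ 0 := by
      rw [Matrix.mulVec_mulVec, Matrix.mul_nonsing_inv _ ((Matrix.isUnit_iff_isUnit_det _).1 hA),
        Matrix.one_mulVec]
    generalize A⁻¹ *ᵥ (B₂ᵀ 0) = v at h
    refine ⟨v 0, v 1, v 2, fun i => ?_⟩
    have := congrFun h i
    simp [hAdef, Matrix.mulVec, dotProduct, Fin.sum_univ_three] at this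
    rw [← this]; ring
  have hxy : x ≠ 0 ∨ y ≠ 0 := by
    by_contra! hh
    obtain ⟨rfl, rfl⟩ := hh
    have := Fintype.linearIndependent_iff.1 hB₂ ![1, -z] (by
      ext i; simp [Fin.sum_univ_two, h i]) 0
    simp at this
  rcases hxy with hx | hy
  · refine ⟨A * !![x, 0, 0; y, 1, 0; 0, 0, 1], !![x, 0; y, 1], !![1, 0; -z, 1],
      hA.mul ?_, ?_, ?_, ?_, ?_⟩
    · simp [Matrix.isUnit_iff_isUnit_det, Matrix.det_fin_three, hx]
    · simp [Matrix.isUnit_iff_isUnit_det, hx]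
    · simp [Matrix.isUnit_iff_isUnit_det]
    · ext i j
      fin_cases j <;> simp [hAdef, Matrix.mul_apply, Fin.sum_univ_succ]
    · ext i j
      fin_cases j <;> simp [hAdef, Matrix.mul_apply, Fin.sum_univ_succ, h i]
      ring
  · refine ⟨A * !![x, 1, 0; y, 0, 0; 0, 0, 1], !![x, 1; y, 0], !![1, 0; -z, 1],
      hA.mul ?_, ?_, ?_, ?_, ?_⟩
    · simp [Matrix.isUnit_iff_isUnit_det, Matrix.det_fin_three, hy]
    · simp [Matrix.isUnit_iff_isUnit_det, hy]
    · simp [Matrix.isUnit_iff_isUnit_det]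
    · ext i j
      fin_cases j <;> simp [hAdef, Matrix.mul_apply, Fin.sum_univ_succ]
    · ext i j
      fin_cases j <;> simp [hAdef, Matrix.mul_apply, Fin.sum_univ_succ, h i]
      ring

/-- Any two sub-rate sinks with max-flow 2 in a rate-3 linear multicast are
simultaneously fully sub-rate decodable. -/
theorem stmt4 {F : Type*} [Field F] (B₁ B₂ : Matrix (Fin 3) (Fin 2) F)
    (hB₁ : LinearIndependent F B₁ᵀ) (hB₂ : LinearIndependent F B₂ᵀ) :
    ∃ (P : Matrix (Fin 3) (Fin 3) F) (D₁ D₂ : Matrix (Fin 2) (Fin 2) F)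
      (R₁ R₂ : Matrix (Fin 3) (Fin 2) F),
      IsUnit P ∧ IsUnit D₁ ∧ IsUnit D₂ ∧
      (∃ f : Fin 2 → Fin 3, Function.Injective f ∧
        ∀ i k, R₁ i k = if i = f k then 1 else 0) ∧
      (∃ g : Fin 2 → Fin 3, Function.Injective g ∧
        ∀ i k, R₂ i k = if i = g k then 1 else 0) ∧
      P * B₁ * D₁ = R₁ ∧ P * B₂ * D₂ = R₂ := by
  have i1 : Function.Injective (![0, 1] : Fin 2 → Fin 3) := by decide
  have i2 : Function.Injective (![0, 2] : Fin 2 → Fin 3) := by decide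
  by_cases h1 : B₂ᵀ 1 ∈ Submodule.span F (Set.range B₁ᵀ)
  · by_cases h0 : B₂ᵀ 0 ∈ Submodule.span F (Set.range B₁ᵀ)
    · obtain ⟨u, hu⟩ := (Submodule.mem_span_range_iff_exists_fun F).1 h0
      obtain ⟨v, hv⟩ := (Submodule.mem_span_range_iff_exists_fun F).1 h1
      obtain ⟨c, hc⟩ : ∃ c, c ∉ Submodule.span F (Set.range B₁ᵀ) := by
        by_contra! hh
        have ht : Submodule.span F (Set.range B₁ᵀ) = ⊤ := by
          rw [eq_top_iff]; exact fun c _ => hh c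
        have := finrank_range_le_card (R := F) B₁ᵀ
        rw [Set.finrank, ht] at this
        simp at this
      let C : Matrix (Fin 2) (Fin 2) F := Matrix.of fun k j => (![u k, v k] : Fin 2 → F) j
      have hBC : B₂ = B₁ * C := by
        ext i j
        have hu' := congrFun hu i
        have hv' := congrFun hv i
        simp [Fin.sum_univ_two] at hu' hv'
        fin_cases j <;> simp [C, Matrix.mul_apply, Fin.sum_univ_two]
        · rw [← hu']; ring
        · rw [← hv']; ring
      have hC : IsUnit C := by
        rw [← Matrix.mulVec_injective_iff_isUnit]
        have hinj : Function.Injective B₂.mulVec := Matrix.mulVec_injective_iff.2 hB₂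
        intro p q hpq
        apply hinj
        change B₂ *ᵥ p = B₂ *ᵥ q
        change C *ᵥ p = C *ᵥ q at hpq
        rw [hBC, ← Matrix.mulVec_mulVec, ← Matrix.mulVec_mulVec, hpq]
      have hCC : C * C⁻¹ = 1 :=
        Matrix.mul_nonsing_inv _ ((Matrix.isUnit_iff_isUnit_det _).1 hC)
      have hs : B₁ = (Matrix.of fun i (j : Fin 3) =>
          (![B₁ i 0, B₁ i 1, c i] : Fin 3 → F) j).submatrix id ![0, 1] := by
        ext i j
        fin_cases j <;> simp
      refine fin_aux B₁ B₂ _ (basis_aux B₁ hB₁ c hc) 1 C⁻¹ isUnit_one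
        ((Matrix.isUnit_nonsing_inv_iff).2 hC) ![0, 1] ![0, 1] i1 i1 ?_ ?_
      · rw [Matrix.mul_one]; exact hs
      · rw [hBC, Matrix.mul_assoc, hCC, Matrix.mul_one]; exact hs
    · have hsw : (B₂.submatrix id (Equiv.swap 0 1))ᵀ = B₂ᵀ ∘ (Equiv.swap (0 : Fin 2) 1) := rfl
      obtain ⟨Q, D₁, D₂, hQ, hD₁, hD₂, e₁, e₂⟩ := case_aux B₁
        (B₂.submatrix id (Equiv.swap 0 1)) hB₁
        (by rw [hsw]; exact hB₂.comp _ (Equiv.injective _))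
        (by
          change B₂ᵀ (Equiv.swap (0 : Fin 2) 1 1) ∉ Submodule.span F (Set.range B₁ᵀ)
          rw [Equiv.swap_apply_right]
          exact h0)
      refine fin_aux B₁ B₂ Q hQ D₁ (!![0, 1; 1, 0] * D₂) hD₁ (IsUnit.mul ?_ hD₂)
        _ _ i1 i2 e₁ ?_
      · simp [Matrix.isUnit_iff_isUnit_det]
      · rw [← e₂, ← Matrix.mul_assoc]
        congr 1
        ext i j
        fin_cases j <;> simp [Matrix.mul_apply, Fin.sum_univ_two]
  · obtain ⟨Q, D₁, D₂, hQ, hD₁, hD₂, e₁, e₂⟩ := case_aux B₁ B₂ hB₁ hB₂ h1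
    exact fin_aux B₁ B₂ Q hQ D₁ D₂ hD₁ hD₂ _ _ i1 i2 e₁ e₂
end

section
/- Let B₁, B₂, B₃ be 3×2 full column rank matrices over a field F whose column spaces have trivial triple intersection. Then there exist an invertible 3×3 matrix P, invertible 2×2 matrices D₁, D₂, D₃, and matrices R₁, R₂, R₃ each consisting of two distinct columns of I₃, such that P·Bᵢ·Dᵢ = Rᵢ for i = 1, 2, 3. -/
open Matrix

lemma aux_normal {F : Type*} [Field F] (B : Matrix (Fin 3) (Fin 2) F)
    (hB : LinearIndependent F Bᵀ) :
    ∃ n : Fin 3 → F, (∀ k, n ⬝ᵥ (Bᵀ k) = 0) ∧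
      ∀ v, n ⬝ᵥ v = 0 → v ∈ Submodule.span F (Set.range Bᵀ) := by
  refine ⟨crossProduct (Bᵀ 0) (Bᵀ 1), ?_, ?_⟩
  · intro k
    fin_cases k <;> simp [cross_apply, dotProduct, Fin.sum_univ_three] <;> ring
  · intro v hv
    by_contra hmem
    have hli : LinearIndependent F (Fin.cons v Bᵀ : Fin 3 → Fin 3 → F) :=
      linearIndependent_finCons.2 ⟨hB, hmem⟩
    have hu : IsUnit (Matrix.of (Fin.cons v Bᵀ : Fin 3 → Fin 3 → F)) :=
      Matrix.linearIndependent_rows_iff_isUnit.1 hli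
    rw [Matrix.isUnit_iff_isUnit_det, isUnit_iff_ne_zero] at hu
    apply hu
    rw [← hv, Matrix.det_fin_three]
    have h0 : ∀ j, (Fin.cons v Bᵀ : Fin 3 → Fin 3 → F) 0 j = v j := fun j => rfl
    have h1 : ∀ j, (Fin.cons v Bᵀ : Fin 3 → Fin 3 → F) 1 j = B j 0 := fun j => rfl
    have h2 : ∀ j, (Fin.cons v Bᵀ : Fin 3 → Fin 3 → F) 2 j = B j 1 := fun j => rfl
    simp [cross_apply, dotProduct, Fin.sum_univ_three, h0, h1, h2]
    ring

lemma aux_reduce {F : Type*} [Field F] (P : Matrix (Fin 3) (Fin 3) F) (hP : IsUnit P)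
    (B : Matrix (Fin 3) (Fin 2) F) (hB : LinearIndependent F Bᵀ) (i : Fin 3)
    (hi : ∀ k, P i ⬝ᵥ (Bᵀ k) = 0) :
    ∃ D : Matrix (Fin 2) (Fin 2) F, IsUnit D ∧
      ∀ r k, (P * B * D) r k = if r = i.succAbove k then 1 else 0 := by
  have hz : ∀ k, (P * B) i k = 0 := hi
  have hBinj : Function.Injective B.mulVec := Matrix.mulVec_injective_iff.2 hB
  have hPinj : Function.Injective P.mulVec := Matrix.mulVec_injective_of_isUnit hP
  set S : Matrix (Fin 2) (Fin 2) F := (P * B).submatrix i.succAbove id with hS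
  have hSu : IsUnit S := by
    rw [← Matrix.mulVec_injective_iff_isUnit]
    intro v w hvw
    apply hBinj
    apply hPinj
    change P *ᵥ (B *ᵥ v) = P *ᵥ (B *ᵥ w)
    rw [Matrix.mulVec_mulVec, Matrix.mulVec_mulVec]
    funext r
    rcases Fin.eq_self_or_eq_succAbove i r with rfl | ⟨j, rfl⟩
    · simp [Matrix.mulVec, dotProduct, hz]
    · exact congrFun hvw j
  have hdet := (Matrix.isUnit_iff_isUnit_det S).1 hSu
  refine ⟨S⁻¹, (Matrix.isUnit_nonsing_inv_iff).2 hSu, ?_⟩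
  intro r k
  rcases Fin.eq_self_or_eq_succAbove i r with rfl | ⟨j, rfl⟩
  · rw [if_neg (Fin.succAbove_ne r k).symm, Matrix.mul_apply]
    simp [hz]
  · have h := congrFun (congrFun (Matrix.mul_nonsing_inv S hdet) j) k
    rw [Matrix.one_apply] at h
    simp only [Fin.succAbove_right_inj]
    exact h


/-- Three sub-rate sinks with max-flow 2 at rate 3 whose column spaces have
trivial triple intersection are fully sub-rate decodable. -/
theorem stmt7 {F : Type*} [Field F] (B₁ B₂ B₃ : Matrix (Fin 3) (Fin 2) F)
    (hB₁ : LinearIndependent F B₁ᵀ) (hB₂ : LinearIndependent F B₂ᵀ)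
    (hB₃ : LinearIndependent F B₃ᵀ)
    (htriv : Submodule.span F (Set.range B₁ᵀ) ⊓ Submodule.span F (Set.range B₂ᵀ) ⊓
      Submodule.span F (Set.range B₃ᵀ) = ⊥) :
    ∃ (P : Matrix (Fin 3) (Fin 3) F) (D₁ D₂ D₃ : Matrix (Fin 2) (Fin 2) F)
      (R₁ R₂ R₃ : Matrix (Fin 3) (Fin 2) F),
      IsUnit P ∧ IsUnit D₁ ∧ IsUnit D₂ ∧ IsUnit D₃ ∧
      (∃ f : Fin 2 → Fin 3, Function.Injective f ∧
        ∀ i k, R₁ i k = if i = f k then 1 else 0) ∧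
      (∃ g : Fin 2 → Fin 3, Function.Injective g ∧
        ∀ i k, R₂ i k = if i = g k then 1 else 0) ∧
      (∃ e : Fin 2 → Fin 3, Function.Injective e ∧
        ∀ i k, R₃ i k = if i = e k then 1 else 0) ∧
      P * B₁ * D₁ = R₁ ∧ P * B₂ * D₂ = R₂ ∧ P * B₃ * D₃ = R₃ := by
  obtain ⟨n₁, hn₁, hs₁⟩ := aux_normal B₁ hB₁
  obtain ⟨n₂, hn₂, hs₂⟩ := aux_normal B₂ hB₂
  obtain ⟨n₃, hn₃, hs₃⟩ := aux_normal B₃ hB₃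
  let P : Matrix (Fin 3) (Fin 3) F := Matrix.of ![n₁, n₂, n₃]
  have hP : IsUnit P := by
    rw [← Matrix.mulVec_injective_iff_isUnit]
    intro v w hvw
    have h0 : P *ᵥ (v - w) = 0 := by rw [Matrix.mulVec_sub]; exact sub_eq_zero.2 hvw
    have hm : v - w ∈ Submodule.span F (Set.range B₁ᵀ) ⊓ Submodule.span F (Set.range B₂ᵀ) ⊓
        Submodule.span F (Set.range B₃ᵀ) :=
      ⟨⟨hs₁ _ (congrFun h0 0), hs₂ _ (congrFun h0 1)⟩, hs₃ _ (congrFun h0 2)⟩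
    rw [htriv, Submodule.mem_bot] at hm
    exact sub_eq_zero.1 hm
  obtain ⟨D₁, hD₁, h₁⟩ := aux_reduce P hP B₁ hB₁ 0 hn₁
  obtain ⟨D₂, hD₂, h₂⟩ := aux_reduce P hP B₂ hB₂ 1 hn₂
  obtain ⟨D₃, hD₃, h₃⟩ := aux_reduce P hP B₃ hB₃ 2 hn₃
  exact ⟨P, D₁, D₂, D₃, _, _, _, hP, hD₁, hD₂, hD₃,
    ⟨_, Fin.succAbove_right_injective, h₁⟩, ⟨_, Fin.succAbove_right_injective, h₂⟩,
    ⟨_, Fin.succAbove_right_injective, h₃⟩, rfl, rfl, rfl⟩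
end
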